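/- arXiv:2603.24188 — 2 statements merged into one kernel-verified Lean document; each statement's English description precedes it below -/
import Mathlib

section
/- Let M be a right module over a right Artinian ring R. Then the following are equivalent: (1) M is super Bassian; (2) M is finitely generated; (3) every quotient of M has finite Goldie (uniform) dimension. -/
/-- A module `M` is *Bassian* if every monomorphism `M → M/N` forces `N = 0`. -/
def IsBassian (R : Type*) [Ring R] (M : Type*) [AddCommGroup M] [Module R M] : Prop :=
  ∀ N : Submodule R M, (∃ f : M →ₗ[R] M ⧸ N, Function.Injective f) → N = ⊥

/-- A module `M` is *super Bassian* if every quotient of `M` is Bassian. -/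
def IsSuperBassian (R : Type*) [Ring R] (M : Type*) [AddCommGroup M] [Module R M] : Prop :=
  ∀ K : Submodule R M, IsBassian R (M ⧸ K)

/-- A module `M` is *hereditarily Bassian* if every submodule of `M` is Bassian. -/
def IsHereditarilyBassian (R : Type*) [Ring R] (M : Type*) [AddCommGroup M] [Module R M] :
    Prop :=
  ∀ N : Submodule R M, IsBassian R N

/-- The property of being Bassian passes from all quotients of `M` to all homomorphic images. -/
theorem IsSuperBassian.isBassian_of_surjective {R M N : Type*} [Ring R] [AddCommGroup M]
    [Module R M] [AddCommGroup N] [Module R N] (h : IsSuperBassian R M) (f : M →ₗ[R] N)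
    (hf : Function.Surjective f) : IsBassian R N := by
  rintro L ⟨g, hg⟩
  let e := f.quotKerEquivOfSurjective hf
  let e' := Submodule.Quotient.equiv L (L.map (e.symm : N →ₗ[R] M ⧸ LinearMap.ker f)) e.symm rfl
  have := h (LinearMap.ker f) _ ⟨e'.toLinearMap ∘ₗ g ∘ₗ e.toLinearMap,
    e'.injective.comp (hg.comp e.injective)⟩
  exact (Submodule.map_eq_bot_iff (p := L) (e := e.symm)).mp this

/-- An infinite direct sum of copies of a nonzero module is not Bassian. -/
theorem IsBassian.finite_of_finsupp {R S ι : Type*} [Ring R] [AddCommGroup S] [Module R S]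
    [Nontrivial S] (h : IsBassian R (ι →₀ S)) : Finite ι := by
  by_contra hι
  rw [not_finite_iff_infinite] at hι
  obtain ⟨E⟩ : Nonempty (Option ι ≃ ι) := Cardinal.eq.mp <| by
    rw [Cardinal.mk_option, Cardinal.add_one_eq (Cardinal.aleph0_le_mk ι)]
  let e : ι → ι := E ∘ some
  have he : Function.Injective e := E.injective.comp (Option.some_injective ι)
  let i := E none
  let N := LinearMap.range (Finsupp.lsingle i : S →ₗ[R] ι →₀ S)
  have hN : N = ⊥ := by
    refine h N ⟨N.mkQ ∘ₗ Finsupp.lmapDomain S R e, ?_⟩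
    rw [← LinearMap.ker_eq_bot, LinearMap.ker_eq_bot']
    intro x hx
    obtain ⟨s, hs⟩ := (Submodule.Quotient.mk_eq_zero N).mp hx
    ext j
    have hij : i ≠ e j := fun H ↦ by simpa using E.injective H
    have := DFunLike.congr_fun hs (e j)
    simpa [Finsupp.mapDomain_apply he, Finsupp.single_eq_of_ne hij.symm] using this.symm
  obtain ⟨s, hs⟩ := exists_ne (0 : S)
  have : Finsupp.single i s ∈ N := ⟨s, rfl⟩
  rw [hN, Submodule.mem_bot, Finsupp.single_eq_zero] at this
  exact hs this

/-- Modules of finite length are Bassian. -/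
theorem isBassian_of_isArtinian_of_isNoetherian (R M : Type*) [Ring R] [AddCommGroup M]
    [Module R M] [IsArtinian R M] [IsNoetherian R M] : IsBassian R M := by
  rintro N ⟨f, hf⟩
  by_contra hN
  exact (Module.length_le_of_injective f hf).not_gt (N.length_quotient_lt hN)

/-- A module over a semiprimary ring which is annihilated by the Jacobson radical is semisimple. -/
theorem IsSemiprimaryRing.isSemisimpleModule_of_isTorsionBySet {R M : Type*} [Ring R]
    [IsSemiprimaryRing R] [AddCommGroup M] [Module R M]
    (h : Module.IsTorsionBySet R M (Ring.jacobson R)) : IsSemisimpleModule R M := by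
  let _ := h.module
  exact (h.semilinearMap.isSemisimpleModule_iff_of_bijective Function.bijective_id).2 inferInstance

/-- A form of Nakayama's lemma: over a semiprimary ring, a module is finite as soon as it is so
modulo the Jacobson radical. -/
theorem IsSemiprimaryRing.finite_of_finite_quotient_jacobson_smul {R M : Type*} [Ring R]
    [IsSemiprimaryRing R] [AddCommGroup M] [Module R M]
    (h : Module.Finite R (M ⧸ (Ring.jacobson R • ⊤ : Submodule R M))) : Module.Finite R M := by
  set J := Ring.jacobson R
  obtain ⟨n, s, hs⟩ := Module.Finite.exists_fin (R := R) (M := M ⧸ (J • ⊤ : Submodule R M))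
  choose t ht using fun i ↦ (J • ⊤ : Submodule R M).mkQ_surjective (s i)
  let F := Submodule.span R (Set.range t)
  have hF : F ⊔ J • ⊤ = ⊤ := by
    have : F.map (J • ⊤ : Submodule R M).mkQ = ⊤ := by
      rw [Submodule.map_span, ← Set.range_comp, ← hs]
      congr 2
      exact funext ht
    rw [sup_comm, ← Submodule.comap_map_mkQ, this, Submodule.comap_top]
  have key (k : ℕ) : F ⊔ J ^ k • ⊤ = ⊤ := by
    induction k with
    | zero => rw [J.pow_zero, Ideal.one_eq_top, Submodule.top_smul, sup_top_eq]
    | succ k ih =>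
      refine eq_top_iff.mpr (hF.ge.trans (sup_le le_sup_left ?_))
      calc J • ⊤ = J • F ⊔ J ^ (k + 1) • ⊤ := by
            rw [← ih, Submodule.smul_sup, ← Submodule.mul_smul, ← Ideal.IsTwoSided.pow_succ, ih]
        _ ≤ F ⊔ J ^ (k + 1) • ⊤ := sup_le_sup_right Submodule.smul_le_right _
  obtain ⟨k, hk⟩ := IsSemiprimaryRing.isNilpotent (R := R)
  have := key k
  rw [hk, Ideal.zero_eq_bot, Submodule.bot_smul, sup_bot_eq] at this
  exact ⟨this ▸ Submodule.fg_span (Set.finite_range t)⟩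

/-- A semisimple module over an Artinian ring has finitely many isotypic components. -/
theorem IsArtinianRing.finite_isotypicComponents (R M : Type*) [Ring R] [IsArtinianRing R]
    [AddCommGroup M] [Module R M] : (isotypicComponents R M).Finite := by
  let A := R ⧸ Ring.jacobson R
  have : IsSemisimpleModule R A :=
    (IsArtinian.isSemisimpleModule_iff_jacobson R A).mpr (Module.jacobson_quotient_jacobson R R)
  choose T hT hdT using fun d : isotypicComponents R A ↦ d.2
  refine (Set.finite_range fun d ↦ isotypicComponent R M (T d)).subset ?_
  rintro _ ⟨S, hS, rfl⟩
  have := IsSimpleModule.nontrivial R S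
  obtain ⟨x, hx⟩ := exists_ne (0 : S)
  let g : A →ₗ[R] S := Submodule.liftQ _ (LinearMap.toSpanSingleton R S x)
    (IsSemisimpleModule.jacobson_le_ker R R R S _)
  have hg : Function.Surjective g := fun y ↦
    have ⟨r, hr⟩ := IsSimpleModule.toSpanSingleton_surjective R hx y
    ⟨Submodule.Quotient.mk r, hr⟩
  obtain ⟨P, ⟨e⟩⟩ := IsSemisimpleModule.exists_submodule_linearEquiv_quotient (LinearMap.ker g)
  let e' := e.trans (g.quotKerEquivOfSurjective hg)
  have : IsSimpleModule R P := .congr e'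
  let d : isotypicComponents R A := ⟨isotypicComponent R A P, P, this, rfl⟩
  have hP : P ≤ isotypicComponent R A (T d) := P.le_isotypicComponent.trans (hdT d).le
  have := hT d
  obtain ⟨e''⟩ := isIsotypicOfType_submodule_iff.mp (.isotypicComponent R A (T d)) P hP
  exact ⟨d, (e''.symm.trans e').isotypicComponent_eq⟩

/-- A semisimple super Bassian module over an Artinian ring is finitely generated. -/
theorem IsSuperBassian.finite_of_isSemisimpleModule {R M : Type*} [Ring R] [IsArtinianRing R]
    [AddCommGroup M] [Module R M] [IsSemisimpleModule R M] (h : IsSuperBassian R M) :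
    Module.Finite R M := by
  have hfg (c : Submodule R M) (hc : c ∈ isotypicComponents R M) : c.FG := by
    have : Nontrivial c :=
      Submodule.nontrivial_iff_ne_bot.mpr (bot_lt_isotypicComponents hc).ne'
    obtain ⟨ι, _, S, _, ⟨e⟩⟩ := (IsIsotypic.isotypicComponents hc).linearEquiv_finsupp
    obtain ⟨c', hc'⟩ := exists_isCompl c
    have := IsSimpleModule.nontrivial R S
    have : Finite ι := IsBassian.finite_of_finsupp (R := R) (S := S) <|
      h.isBassian_of_surjective (e ∘ₗ c.projectionOnto c' hc')
        (e.surjective.comp (Submodule.projectionOnto_surjective hc'))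
    have : Module.Finite R c := .equiv e.symm
    exact Module.Finite.iff_fg.mp this
  have : (sSup (isotypicComponents R M)).FG := by
    have := (IsArtinianRing.finite_isotypicComponents R M).to_subtype
    rw [sSup_eq_iSup']
    exact Submodule.fg_iSup _ fun c ↦ hfg c c.2
  exact ⟨sSup_isotypicComponents R M ▸ this⟩

/-- A semisimple module of finite Goldie dimension is finitely generated. -/
theorem IsSemisimpleModule.finite_of_not_exists_iSupIndep {R M : Type*} [Ring R]
    [AddCommGroup M] [Module R M] [IsSemisimpleModule R M]
    (h : ¬ ∃ f : ℕ → Submodule R M, (∀ n, f n ≠ ⊥) ∧ iSupIndep f) : Module.Finite R M := by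
  obtain ⟨s, hs, hsup, hsimple⟩ := IsSemisimpleModule.exists_sSupIndep_sSup_simples_eq_top R M
  have := (IsSemisimpleModule.finite_tfae (R := R) (M := M)).out 4 0
  refine this.mp ⟨s, ?_, hs, hsup, hsimple⟩
  by_contra hinf
  let g := Set.Infinite.natEmbedding s hinf
  refine h ⟨fun n ↦ g n, fun n ↦ ?_, ((sSupIndep_iff s).mp hs).comp g.injective⟩
  exact (isSimpleModule_iff_isAtom.mp (hsimple _ (g n).2)).1

/-- Over an Artinian ring, a module is super Bassian iff it is finitely generated iff every
quotient of it has finite Goldie (uniform) dimension. -/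
theorem artinian_superBassian_tfae (R : Type*) [Ring R] [IsArtinianRing R] (M : Type*)
    [AddCommGroup M] [Module R M] :
    List.TFAE
      [IsSuperBassian R M,
       Module.Finite R M,
       ∀ K : Submodule R M,
         ¬ ∃ f : ℕ → Submodule R (M ⧸ K), (∀ n, f n ≠ ⊥) ∧ iSupIndep f] := by
  have : IsSemisimpleModule R (M ⧸ (Ring.jacobson R • ⊤ : Submodule R M)) := by
    refine IsSemiprimaryRing.isSemisimpleModule_of_isTorsionBySet ?_
    rw [Module.isTorsionBySet_quotient_iff]
    exact fun m r hr ↦ Submodule.smul_mem_smul hr trivial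
  tfae_have 2 → 1 := fun _ K ↦ isBassian_of_isArtinian_of_isNoetherian R (M ⧸ K)
  tfae_have 2 → 3 := by
    rintro _ K ⟨f, hf, hind⟩
    have := WellFoundedGT.finite_of_iSupIndep hind hf
    exact not_finite ℕ
  tfae_have 1 → 2 := by
    refine fun h ↦ IsSemiprimaryRing.finite_of_finite_quotient_jacobson_smul
      (IsSuperBassian.finite_of_isSemisimpleModule fun K ↦ ?_)
    exact h.isBassian_of_surjective (K.mkQ ∘ₗ Submodule.mkQ _)
      (K.mkQ_surjective.comp (Submodule.mkQ_surjective _))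
  tfae_have 3 → 2 := fun h ↦ IsSemiprimaryRing.finite_of_finite_quotient_jacobson_smul
    (IsSemisimpleModule.finite_of_not_exists_iSupIndep (h _))
  tfae_finish
end

section
/- Let M be a right module over a quasi-Frobenius ring R. Then the following are equivalent: (1) M is hereditarily Bassian; (2) M is finitely generated; (3) Soc(M) is finitely generated. -/
/-- The *socle* of a module: the sum of all its simple submodules, i.e. the supremum of
the atoms of its submodule lattice. -/
def Socle (R : Type*) [Ring R] (M : Type*) [AddCommGroup M] [Module R M] : Submodule R M :=
  sSup {N : Submodule R M | IsAtom N}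

/-- Over a left self-injective ring, finitely generated right ideals are right annihilators. -/
theorem Module.Baer.exists_eq_sum_mul {R : Type*} [Ring R] (hR : Module.Baer R R)
    {ι : Type*} [Fintype ι] (a : ι → R) (b : R)
    (hb : ∀ x : R, (∀ i, x * a i = 0) → x * b = 0) :
    ∃ r : ι → R, b = ∑ i, a i * r i := by
  classical
  let F : R →ₗ[R] ι → R := LinearMap.pi fun i ↦ LinearMap.toSpanSingleton R R (a i)
  let g : R →ₗ[R] R := LinearMap.toSpanSingleton R R b
  have hFg : LinearMap.ker F ≤ LinearMap.ker g := fun x hx ↦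
    hb x fun i ↦ congrFun (LinearMap.mem_ker.1 hx) i
  obtain ⟨h, hh⟩ := hR.extension_property ((LinearMap.ker F).liftQ F le_rfl)
    (LinearMap.ker_eq_bot.1 (Submodule.ker_liftQ_eq_bot _ _ _ le_rfl))
    ((LinearMap.ker F).liftQ g hFg)
  refine ⟨fun i ↦ h (Pi.single i 1), ?_⟩
  have h1 := LinearMap.congr_fun hh (Submodule.Quotient.mk 1)
  simp only [LinearMap.comp_apply, Submodule.liftQ_apply, g, LinearMap.toSpanSingleton_apply,
    one_smul] at h1
  have h2 : F 1 = a := by ext i; simp [F]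
  rw [h2, LinearMap.pi_apply_eq_sum_univ] at h1
  rw [← h1]
  refine Finset.sum_congr rfl fun i _ ↦ ?_
  rw [smul_eq_mul]
  congr 2
  ext j
  simp [Pi.single_apply, eq_comm]

theorem Module.Baer.exists_eq_mul {R : Type*} [Ring R] (hR : Module.Baer R R) (a b : R)
    (hb : ∀ x : R, x * a = 0 → x * b = 0) : ∃ r, b = a * r := by
  obtain ⟨r, hr⟩ := hR.exists_eq_sum_mul (fun _ : Unit ↦ a) b fun x hx ↦ hb x (hx ())
  exact ⟨r (), by simpa using hr⟩

/-- An element `a` such that every `1 - a * r` is right invertible lies in the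
Jacobson radical. -/
theorem Ring.mem_jacobson_of_one_sub_mul {R : Type*} [Ring R] {a : R}
    (ha : ∀ r, ∃ u, (1 - a * r) * u = 1) : a ∈ Ring.jacobson R := by
  rw [← Ideal.jacobson_bot, Ideal.mem_jacobson_iff]
  intro y
  obtain ⟨u, hu⟩ := ha (-y)
  obtain ⟨v, hv⟩ := ha (y * u)
  have h1 : 1 - a * (y * u) = u := by
    rw [← hu]; noncomm_ring
  rw [h1] at hv
  have h2 : v = 1 - a * -y := by
    calc v = ((1 - a * -y) * u) * v := by rw [hu, one_mul]
      _ = _ := by rw [mul_assoc, hv, mul_one]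
  rw [h2] at hv
  refine ⟨1 - y * u * a, ?_⟩
  rw [Ideal.mem_bot]
  have h3 : u * a * y = 1 - u := by
    have : u * (1 - a * -y) = u + u * a * y := by noncomm_ring
    rw [hv] at this
    rw [this]; abel
  calc _ = y * (1 - u - u * a * y) * a := by noncomm_ring
    _ = 0 := by rw [h3]; simp

theorem Ring.exists_one_sub_mul_eq_one {R : Type*} [Ring R] {x : R}
    (hx : x ∈ Ring.jacobson R) : ∃ z, (1 - x) * z = 1 := by
  have left {y : R} (hy : y ∈ Ring.jacobson R) : ∃ z, z * (1 - y) = 1 := by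
    rw [← Ideal.jacobson_bot, Ideal.mem_jacobson_iff] at hy
    obtain ⟨z, hz⟩ := hy (-1)
    refine ⟨z, sub_eq_zero.1 ?_⟩
    rw [← Ideal.mem_bot.1 hz]
    noncomm_ring
  obtain ⟨z, hz⟩ := left hx
  obtain ⟨w, hw⟩ := left (neg_mem (Ideal.mul_mem_left _ z hx))
  have hzx : 1 - -(z * x) = z := by rw [← hz]; noncomm_ring
  rw [hzx] at hw
  exact ⟨z, by rw [← left_inv_eq_right_inv hw hz, hw]⟩

/-- A left Noetherian, left self-injective ring has nilpotent Jacobson radical. -/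
theorem Module.Baer.isNilpotent_jacobson {R : Type*} [Ring R] [IsNoetherianRing R]
    (hR : Module.Baer R R) : IsNilpotent (Ring.jacobson R) := by
  set J := Ring.jacobson R
  let L : ℕ →o Ideal R := ⟨fun n ↦ Submodule.annihilator (J ^ n), fun m n h ↦
    Submodule.annihilator_mono (Ideal.pow_le_pow_right h)⟩
  obtain ⟨n, hn⟩ := monotone_stabilizes_iff_noetherian.2 ‹IsNoetherian R R› L
  have hL : L (n + 1) = L (n + 2) := (hn _ (by lia)).symm.trans (hn _ (by lia))
  refine ⟨n + 1, ?_⟩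
  by_contra hne
  let s : Set (Ideal R) :=
    {K | ∃ a ∉ L (n + 1), K = LinearMap.ker (LinearMap.toSpanSingleton R R a)}
  have hs : s.Nonempty := by
    refine ⟨_, 1, fun h ↦ hne ?_, rfl⟩
    refine (Submodule.eq_bot_iff _).2 fun x hx ↦ ?_
    simpa using Submodule.mem_annihilator.1 h x hx
  obtain ⟨_, ⟨a, ha, rfl⟩, hmax⟩ := set_has_maximal_iff_noetherian.2 ‹IsNoetherian R R› s hs
  obtain ⟨b, hb, hab⟩ : ∃ b ∈ J, a * b ∉ L (n + 1) := by
    by_contra! hcon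
    refine ha ?_
    rw [hL]
    refine Submodule.mem_annihilator.2 fun x hx ↦ ?_
    rw [Submodule.pow_succ' J (Nat.succ_ne_zero n)] at hx
    refine Submodule.mul_induction_on hx (fun b hb y hy ↦ ?_) fun x y hx hy ↦ ?_
    · rw [smul_eq_mul, ← mul_assoc]
      exact Submodule.mem_annihilator.1 (hcon b hb) y hy
    · rw [smul_add, hx, hy, add_zero]
  have hle : LinearMap.ker (LinearMap.toSpanSingleton R R a) ≤
      LinearMap.ker (LinearMap.toSpanSingleton R R (a * b)) := fun x hx ↦ by
    simp only [LinearMap.mem_ker, LinearMap.toSpanSingleton_apply, smul_eq_mul] at hx ⊢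
    rw [← mul_assoc, hx, zero_mul]
  have heq := hle.eq_of_not_lt (hmax _ ⟨_, hab, rfl⟩)
  obtain ⟨r, hr⟩ := hR.exists_eq_mul (a * b) a fun x hx ↦ by
    have : x ∈ LinearMap.ker (LinearMap.toSpanSingleton R R a) := heq ▸ hx
    exact this
  obtain ⟨v, hv⟩ := Ring.exists_one_sub_mul_eq_one (Ideal.mul_mem_right r _ hb : b * r ∈ J)
  refine ha ?_
  have h0 : a * (1 - b * r) = 0 := by
    rw [mul_sub, mul_one, ← mul_assoc, ← hr, sub_self]
  have : a = 0 := by rw [← mul_one a, ← hv, ← mul_assoc, h0, zero_mul]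
  rw [this]; exact zero_mem _

/-- A left Noetherian, left self-injective ring is semisimple modulo its Jacobson radical. -/
theorem Module.Baer.isSemisimpleRing_quotient_jacobson {R : Type*} [Ring R] [IsNoetherianRing R]
    (hR : Module.Baer R R) : IsSemisimpleRing (R ⧸ Ring.jacobson R) := by
  set J := Ring.jacobson R
  have key (L : Ideal R) : ∃ x ∈ L, ∀ l ∈ L, l * (1 - x) ∈ J := by
    let s : Set (Ideal R) :=
      {K | ∃ x ∈ L, K = LinearMap.ker (LinearMap.toSpanSingleton R R (1 - x))}
    obtain ⟨_, ⟨x, hx, rfl⟩, hmax⟩ := set_has_maximal_iff_noetherian.2 ‹IsNoetherian R R› s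
      ⟨_, 0, zero_mem _, rfl⟩
    refine ⟨x, hx, fun l hl ↦ ?_⟩
    refine Ring.mem_jacobson_of_one_sub_mul fun r ↦ ?_
    set a := l * (1 - x) with ha
    have haL : a ∈ L := by
      rw [ha, mul_sub, mul_one]; exact sub_mem hl (Ideal.mul_mem_left _ _ hx)
    set y := x + (1 - x) * r * a
    have hy : y ∈ L := add_mem hx (Ideal.mul_mem_left _ _ haL)
    have hyx : 1 - y = (1 - x) * (1 - r * a) := by simp only [y]; noncomm_ring
    have hle : LinearMap.ker (LinearMap.toSpanSingleton R R (1 - x)) ≤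
        LinearMap.ker (LinearMap.toSpanSingleton R R (1 - y)) := fun z hz ↦ by
      simp only [LinearMap.mem_ker, LinearMap.toSpanSingleton_apply, smul_eq_mul] at hz ⊢
      rw [hyx, ← mul_assoc, hz, zero_mul]
    have heq := hle.eq_of_not_lt (hmax _ ⟨_, hy, rfl⟩)
    obtain ⟨t, ht⟩ := hR.exists_eq_mul (1 - y) (1 - x) fun z hz ↦ by
      have : z ∈ LinearMap.ker (LinearMap.toSpanSingleton R R (1 - x)) := heq ▸ hz
      exact this
    have hat : a = (1 - a * r) * (a * t) := by
      calc a = l * ((1 - y) * t) := by rw [← ht]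
        _ = (a - a * r * a) * t := by rw [hyx, ha]; noncomm_ring
        _ = _ := by noncomm_ring
    refine ⟨1 + a * t * r, ?_⟩
    calc _ = 1 - a * r + ((1 - a * r) * (a * t)) * r := by noncomm_ring
      _ = 1 := by rw [← hat]; abel
  have hcompl : IsSemisimpleModule R (R ⧸ J) := by
    rw [isSemisimpleModule_iff]
    refine ⟨fun K ↦ ?_⟩
    obtain ⟨x, hx, hxJ⟩ := key (K.comap J.mkQ)
    refine ⟨(Submodule.span R {1 - x}).map J.mkQ, ?_⟩
    rw [isCompl_iff, Submodule.disjoint_def, codisjoint_iff, eq_top_iff]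
    constructor
    · rintro _ hK ⟨z, hz, rfl⟩
      obtain ⟨u, rfl⟩ := Submodule.mem_span_singleton.1 hz
      rw [smul_eq_mul] at hK ⊢
      have h1 := hxJ _ hK
      have h2 : u * (x * (1 - x)) ∈ J := Ideal.mul_mem_left _ _ (hxJ x hx)
      rw [Submodule.mkQ_apply, Submodule.Quotient.mk_eq_zero]
      convert add_mem h1 h2 using 1
      noncomm_ring
    · intro z _
      obtain ⟨z, rfl⟩ := J.mkQ_surjective z
      have : z = z * x + z * (1 - x) := by noncomm_ring
      rw [this, map_add]
      exact Submodule.add_mem_sup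
        ((K.comap J.mkQ).smul_mem z hx)
        (Submodule.mem_map_of_mem (Submodule.smul_mem _ z (Submodule.mem_span_singleton_self _)))
  let l : (R ⧸ J) →ₛₗ[Ideal.Quotient.mk J] (R ⧸ J) :=
    { toFun := id
      map_add' := fun _ _ ↦ rfl
      map_smul' := fun r x ↦ rfl }
  exact (l.isSemisimpleModule_iff_of_bijective Function.bijective_id).1 hcompl

/-- A left Noetherian, left self-injective ring is left Artinian. -/
theorem Module.Baer.isArtinianRing {R : Type*} [Ring R] [IsNoetherianRing R]
    (hR : Module.Baer R R) : IsArtinianRing R :=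
  have : IsSemiprimaryRing R := ⟨hR.isSemisimpleRing_quotient_jacobson, hR.isNilpotent_jacobson⟩
  (IsSemiprimaryRing.isNoetherian_iff_isArtinian (R := R) (M := R)).1 ‹_›

/-- A simple module that receives a nonzero map killing the common kernel of finitely many maps
to simple modules is isomorphic to one of these simple modules. -/
theorem IsSimpleModule.exists_linearEquiv_of_iInf_ker_le {R : Type*} [Ring R] {X T : Type*}
    [AddCommGroup X] [Module R X] [AddCommGroup T] [Module R T] [IsSimpleModule R T]
    {ι : Type*} [Finite ι] {S : ι → Type*} [∀ i, AddCommGroup (S i)] [∀ i, Module R (S i)]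
    [∀ i, IsSimpleModule R (S i)] (f : ∀ i, X →ₗ[R] S i) (g : X →ₗ[R] T)
    (hg : g ≠ 0) (h : ⨅ i, LinearMap.ker (f i) ≤ LinearMap.ker g) :
    ∃ i, Nonempty (T ≃ₗ[R] S i) := by
  let F : X →ₗ[R] ∀ i, S i := LinearMap.pi f
  have hF : LinearMap.ker F ≤ LinearMap.ker g := by rwa [LinearMap.ker_pi]
  let j := (LinearMap.ker F).liftQ F le_rfl
  have hj : Function.Injective j :=
    LinearMap.ker_eq_bot.1 (Submodule.ker_liftQ_eq_bot _ _ _ le_rfl)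
  have : IsSemisimpleModule R (X ⧸ LinearMap.ker F) := IsSemisimpleModule.of_injective j hj
  have hne : (LinearMap.ker F).liftQ g hF ≠ 0 := fun h0 ↦ hg <| by
    rw [← Submodule.liftQ_mkQ _ g hF, h0, LinearMap.zero_comp]
  obtain ⟨W, ⟨e⟩⟩ := LinearMap.linearEquiv_of_ne_zero hne
  let k : T →ₗ[R] ∀ i, S i := j ∘ₗ W.subtype ∘ₗ e.toLinearMap
  have hk : Function.Injective k :=
    hj.comp (W.injective_subtype.comp e.injective)
  by_contra! hcon
  have hzero (i) : LinearMap.proj i ∘ₗ k = 0 := by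
    by_contra hi
    exact (hcon i).elim (LinearEquiv.ofBijective _ (LinearMap.bijective_of_ne_zero hi))
  have := IsSimpleModule.nontrivial R T
  obtain ⟨t, ht⟩ := exists_ne (0 : T)
  refine ht (hk ?_)
  rw [map_zero]
  ext i
  exact LinearMap.congr_fun (hzero i) t

/-- Over an Artinian ring, a simple module is determined by its annihilator. -/
theorem IsArtinianRing.nonempty_linearEquiv_of_annihilator_le {R : Type*} [Ring R]
    [IsArtinianRing R] {S T : Type*} [AddCommGroup S] [Module R S] [IsSimpleModule R S]
    [AddCommGroup T] [Module R T] [IsSimpleModule R T]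
    (h : Module.annihilator R S ≤ Module.annihilator R T) : Nonempty (T ≃ₗ[R] S) := by
  obtain ⟨t, ht⟩ := Finset.exists_inf_le
    fun s : S ↦ LinearMap.ker (LinearMap.toSpanSingleton R S s)
  have := IsSimpleModule.nontrivial R T
  obtain ⟨y, hy⟩ := exists_ne (0 : T)
  obtain ⟨-, h⟩ := IsSimpleModule.exists_linearEquiv_of_iInf_ker_le
    (fun s : t ↦ LinearMap.toSpanSingleton R S s.1) (LinearMap.toSpanSingleton R T y)
    (fun h0 ↦ hy (by simpa using LinearMap.congr_fun h0 1)) (fun r hr ↦ by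
      refine Module.mem_annihilator.1 (h (Module.mem_annihilator.2 fun s ↦ ?_)) y
      refine ht s ?_
      rw [Finset.inf_eq_iInf]
      simpa using hr)
  exact h

/-- Over an Artinian ring there are finitely many isomorphism classes of simple modules. -/
theorem IsArtinianRing.exists_finset_linearEquiv_quotient (R : Type*) [Ring R]
    [IsArtinianRing R] : ∃ t : Finset {m : Ideal R // m.IsMaximal},
      ∀ (T : Type*) [AddCommGroup T] [Module R T] [IsSimpleModule R T],
        ∃ m : t, Nonempty (T ≃ₗ[R] R ⧸ m.1.1) := by
  obtain ⟨t, ht⟩ := Finset.exists_inf_le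
    (Subtype.val : {m : Ideal R // m.IsMaximal} → Ideal R)
  refine ⟨t, fun T _ _ _ ↦ ?_⟩
  have := IsSimpleModule.nontrivial R T
  obtain ⟨y, hy⟩ := exists_ne (0 : T)
  have (m : t) : IsSimpleModule R (R ⧸ m.1.1) :=
    isSimpleModule_iff_isCoatom.2 (Ideal.isMaximal_def.1 m.1.2)
  refine IsSimpleModule.exists_linearEquiv_of_iInf_ker_le
    (fun m : t ↦ m.1.1.mkQ) (LinearMap.toSpanSingleton R T y)
    (fun h0 ↦ hy (by simpa using LinearMap.congr_fun h0 1)) ?_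
  refine le_trans (le_of_eq ?_) (ht ⟨_, IsSimpleModule.ker_toSpanSingleton_isMaximal R hy⟩)
  simp [Finset.inf_eq_iInf, iInf_subtype]

/-- Over a left Artinian, left self-injective ring, every proper two-sided ideal has a nonzero
left annihilator. -/
theorem Module.Baer.exists_ne_zero_forall_mul_eq_zero {R : Type*} [Ring R] [IsArtinianRing R]
    (hR : Module.Baer R R) (P : Ideal R) [P.IsTwoSided] (hP : P ≠ ⊤) :
    ∃ x : R, x ≠ 0 ∧ ∀ p ∈ P, x * p = 0 := by
  obtain ⟨t, ht⟩ := Finset.exists_inf_le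
    fun p : P ↦ LinearMap.ker (LinearMap.toSpanSingleton R R p.1)
  by_contra! hcon
  obtain ⟨r, hr⟩ := hR.exists_eq_sum_mul (fun p : t ↦ p.1.1) 1 fun x hx ↦ by
    by_contra hx0
    rw [mul_one] at hx0
    obtain ⟨p, hp, hxp⟩ := hcon x hx0
    refine hxp (ht ⟨p, hp⟩ ?_)
    rw [Finset.inf_eq_iInf]
    simpa using fun p hp hpt ↦ hx ⟨⟨p, hp⟩, hpt⟩
  refine hP ((Ideal.eq_top_iff_one _).2 ?_)
  rw [hr]
  exact Submodule.sum_mem _ fun p _ ↦ Ideal.mul_mem_right _ _ p.1.2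

/-- Over a left Artinian, left self-injective ring every simple module embeds into the ring. -/
theorem Module.Baer.exists_injective_of_isSimpleModule {R : Type*} [Ring R] [IsArtinianRing R]
    (hR : Module.Baer R R) (T : Type*) [AddCommGroup T] [Module R T] [IsSimpleModule R T] :
    ∃ f : T →ₗ[R] R, Function.Injective f := by
  let A : Set (Ideal R) := {P | ∃ m : Ideal R, m.IsMaximal ∧ P = Module.annihilator R (R ⧸ m)}
  have hmax {m : Ideal R} (hm : m.IsMaximal) : IsSimpleModule R (R ⧸ m) :=
    isSimpleModule_iff_isCoatom.2 (Ideal.isMaximal_def.1 hm)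
  have hmem (I : Ideal R) [IsSimpleModule R I] : Module.annihilator R I ∈ A := by
    obtain ⟨m, hm, ⟨e⟩⟩ := isSimpleModule_iff_quot_maximal.1 ‹IsSimpleModule R I›
    exact ⟨m, hm, e.annihilator_eq⟩
  obtain ⟨t, ht⟩ := IsArtinianRing.exists_finset_linearEquiv_quotient R
  have hfin : A.Finite := by
    refine (Set.finite_range fun m : t ↦ Module.annihilator R (R ⧸ m.1.1)).subset ?_
    rintro _ ⟨m, hm, rfl⟩
    have := hmax hm
    obtain ⟨m', ⟨e⟩⟩ := ht (R ⧸ m)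
    exact ⟨m', e.annihilator_eq.symm⟩
  have := hfin.to_subtype
  have hcomax (P Q : A) (h : P.1 ⊔ Q.1 ≠ ⊤) : P = Q := by
    obtain ⟨n, hn, hle⟩ := Ideal.exists_le_maximal _ h
    have := hmax hn
    have aux (P : A) (hPn : P.1 ≤ n) : P.1 = Module.annihilator R (R ⧸ n) := by
      obtain ⟨_, m, hm, rfl⟩ := P
      have := hmax hm
      obtain ⟨e⟩ := IsArtinianRing.nonempty_linearEquiv_of_annihilator_le
        (S := R ⧸ m) (T := R ⧸ n) fun p hp ↦ Module.mem_annihilator.2 fun x ↦ by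
          obtain ⟨x, rfl⟩ := n.mkQ_surjective x
          rw [← map_smul]
          exact (Submodule.Quotient.mk_eq_zero _).2 (hPn (Ideal.mul_mem_right _ _ hp))
      exact e.annihilator_eq.symm
    exact Subtype.ext ((aux P (le_sup_left.trans hle)).trans (aux Q (le_sup_right.trans hle)).symm)
  have hex (P : A) : ∃ S : Ideal R, IsSimpleModule R S ∧ ∀ x ∈ S, ∀ p ∈ P.1, x * p = 0 := by
    obtain ⟨_, m, hm, rfl⟩ := P
    have := hmax hm
    have := IsSimpleModule.nontrivial R (R ⧸ m)
    obtain ⟨x, hx, hxP⟩ := hR.exists_ne_zero_forall_mul_eq_zero (Module.annihilator R (R ⧸ m))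
      fun h ↦ not_subsingleton (R ⧸ m) (Module.annihilator_eq_top_iff.1 h)
    obtain ⟨S, hS, hle⟩ := (IsAtomic.eq_bot_or_exists_atom_le (Submodule.span R {x})).resolve_left
      (by simpa using hx)
    refine ⟨S, isSimpleModule_iff_isAtom.2 hS, fun y hy p hp ↦ ?_⟩
    obtain ⟨r, rfl⟩ := Submodule.mem_span_singleton.1 (hle hy)
    rw [smul_eq_mul, mul_assoc, hxP p hp, mul_zero]
  choose S hS hSP using hex
  let σ : A → A := fun P ↦ ⟨Module.annihilator R (S P), hmem (S P)⟩
  have hσ : Function.Injective σ := fun P Q hPQ ↦ by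
    by_contra hne
    have htop : P.1 ⊔ Q.1 = ⊤ := by
      by_contra h; exact hne (hcomax P Q h)
    obtain ⟨e⟩ := IsArtinianRing.nonempty_linearEquiv_of_annihilator_le
      (S := S Q) (T := S P) (Subtype.ext_iff.1 hPQ).ge
    obtain ⟨h, hh⟩ := hR.extension_property (S P).subtype (S P).injective_subtype
      ((S Q).subtype ∘ₗ e.toLinearMap)
    have hmul (x : S P) : (e x : R) = x * h 1 := by
      rw [← smul_eq_mul, ← map_smul, smul_eq_mul, mul_one]
      exact (LinearMap.congr_fun hh x).symm
    have := IsSimpleModule.nontrivial R (S P)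
    obtain ⟨x, hx⟩ := exists_ne (0 : S P)
    refine hx (e.injective (Subtype.ext ?_))
    obtain ⟨p, hp, q, hq, hpq⟩ := Submodule.mem_sup.1 ((Ideal.eq_top_iff_one _).1 htop)
    calc (e x : R) = (e x : R) * p + e x * q := by rw [← mul_add, hpq, mul_one]
      _ = x * (h 1 * p) + e x * q := by rw [hmul x, mul_assoc]
      _ = 0 := by
        rw [hSP P x x.2 _ (Ideal.mul_mem_left _ _ hp), hSP Q _ (e x).2 q hq, add_zero]
      _ = (e 0 : S Q) := by simp
  obtain ⟨m, hm, ⟨e⟩⟩ := isSimpleModule_iff_quot_maximal.1 ‹IsSimpleModule R T›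
  obtain ⟨P, hP⟩ := (Finite.injective_iff_surjective.1 hσ) ⟨_, m, hm, rfl⟩
  obtain ⟨e⟩ := IsArtinianRing.nonempty_linearEquiv_of_annihilator_le
    (S := S P) (T := T) ((Subtype.ext_iff.1 hP).trans e.annihilator_eq.symm).le
  exact ⟨(S P).subtype ∘ₗ e.toLinearMap, (S P).injective_subtype.comp e.injective⟩

theorem IsNoetherian.isBassian (R : Type*) [Ring R] (M : Type*) [AddCommGroup M] [Module R M]
    [IsNoetherian R M] : IsBassian R M := by
  rintro N ⟨f, hf⟩
  rw [← N.ker_mkQ]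
  exact LinearMap.ker_eq_bot.2
    (IsNoetherian.injective_of_surjective_of_injective f N.mkQ hf N.mkQ_surjective)

theorem IsNoetherian.isHereditarilyBassian (R : Type*) [Ring R] (M : Type*) [AddCommGroup M]
    [Module R M] [IsNoetherian R M] : IsHereditarilyBassian R M :=
  fun N ↦ IsNoetherian.isBassian R N

theorem IsBassian.injective_of_surjective {R : Type*} [Ring R] {M : Type*} [AddCommGroup M]
    [Module R M] (h : IsBassian R M) (f : M →ₗ[R] M) (hf : Function.Surjective f) :
    Function.Injective f :=
  LinearMap.ker_eq_bot.1 <| h _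
    ⟨(f.quotKerEquivOfSurjective hf).symm.toLinearMap, LinearEquiv.injective _⟩

theorem IsBassian.of_linearEquiv {R : Type*} [Ring R] {M M' : Type*} [AddCommGroup M]
    [Module R M] [AddCommGroup M'] [Module R M'] (e : M ≃ₗ[R] M') (h : IsBassian R M) :
    IsBassian R M' := by
  rintro N ⟨f, hf⟩
  let e' : (M ⧸ N.comap e.toLinearMap) ≃ₗ[R] M' ⧸ N :=
    Submodule.Quotient.equiv _ _ e (Submodule.map_comap_eq_of_surjective e.surjective N)
  have := h (N.comap e.toLinearMap)
    ⟨e'.symm.toLinearMap ∘ₗ f ∘ₗ e.toLinearMap, e'.symm.injective.comp (hf.comp e.injective)⟩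
  rw [← Submodule.map_comap_eq_of_surjective e.surjective N]
  exact (congrArg (Submodule.map e.toLinearMap) this).trans (Submodule.map_bot _)

theorem not_isBassian_finsupp_nat (R : Type*) [Ring R] (S : Type*) [AddCommGroup S] [Module R S]
    [Nontrivial S] : ¬ IsBassian R (ℕ →₀ S) := fun h ↦ by
  have hinj := h.injective_of_surjective (Finsupp.lcomapDomain Nat.succ Nat.succ_injective)
    (Finsupp.leftInverse_lcomapDomain_mapDomain Nat.succ Nat.succ_injective).surjective
  obtain ⟨s, hs⟩ := exists_ne (0 : S)
  refine hs (Finsupp.single_eq_zero.1 (hinj (a₁ := Finsupp.single 0 s) (a₂ := 0) ?_))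
  ext n
  simp [Finsupp.lcomapDomain]

/-- A hereditarily Bassian module contains no infinite direct sum of copies of a nonzero module. -/
theorem IsHereditarilyBassian.not_iSupIndep {R : Type*} [Ring R] {M : Type*} [AddCommGroup M]
    [Module R M] (h : IsHereditarilyBassian R M) {S : Type*} [AddCommGroup S] [Module R S]
    [Nontrivial S] (A : ℕ → Submodule R M) (e : ∀ n, S ≃ₗ[R] A n) : ¬ iSupIndep A := fun hA ↦ by
  classical
  let e' : (ℕ →₀ S) ≃ₗ[R] Π₀ n, A n :=
    (finsuppLequivDFinsupp R).trans (DFinsupp.mapRange.linearEquiv e)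
  let j : (ℕ →₀ S) →ₗ[R] M := DFinsupp.lsum ℕ (fun n ↦ (A n).subtype) ∘ₗ e'.toLinearMap
  have hj : Function.Injective j := hA.dfinsupp_lsum_injective.comp e'.injective
  exact not_isBassian_finsupp_nat R S
    ((h (LinearMap.range j)).of_linearEquiv (LinearEquiv.ofInjective j hj).symm)

/-- Over an Artinian ring, the socle of a hereditarily Bassian module is finitely generated. -/
theorem IsHereditarilyBassian.socle_fg {R : Type*} [Ring R] [IsArtinianRing R] {M : Type*}
    [AddCommGroup M] [Module R M] (h : IsHereditarilyBassian R M) : (Socle R M).FG := by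
  have hatoms : sSup {N ≤ Socle R M | IsAtom N} = Socle R M := by
    congr 1
    ext N
    exact ⟨fun hN ↦ hN.2, fun hN ↦ ⟨le_sSup hN, hN⟩⟩
  obtain ⟨s, hind, hs, hsat⟩ := exists_sSupIndep_of_sSup_atoms _ hatoms
  have hsimple (N : s) : IsSimpleModule R N.1 := isSimpleModule_iff_isAtom.2 (hsat N.2)
  rw [← hs]
  by_cases hfin : s.Finite
  · have := hfin.to_subtype
    rw [sSup_eq_iSup']
    exact Submodule.fg_iSup _ fun N ↦ Module.Finite.iff_fg.1 inferInstance
  · have := Set.infinite_coe_iff.2 hfin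
    obtain ⟨t, ht⟩ := IsArtinianRing.exists_finset_linearEquiv_quotient R
    choose c hc using fun N : s ↦ ht N.1
    obtain ⟨m, hm⟩ := Finite.exists_infinite_fiber c
    let ν := Infinite.natEmbedding (c ⁻¹' {m})
    have : IsSimpleModule R (R ⧸ m.1.1) :=
      isSimpleModule_iff_isCoatom.2 (Ideal.isMaximal_def.1 m.1.2)
    have := IsSimpleModule.nontrivial R (R ⧸ m.1.1)
    have he (n : ℕ) : Nonempty ((R ⧸ m.1.1) ≃ₗ[R] (ν n).1.1) := by
      obtain ⟨e⟩ := hc (ν n).1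
      rw [show c (ν n).1 = m from (ν n).2] at e
      exact ⟨e.symm⟩
    refine (h.not_iSupIndep (fun n ↦ (ν n).1.1) (fun n ↦ (he n).some) ?_).elim
    exact ((sSupIndep_iff s).1 hind).comp (f := fun n ↦ (ν n).1)
      (Subtype.val_injective.comp ν.injective)

/-- Over a left Artinian ring, every nonzero submodule meets the socle. -/
theorem IsArtinianRing.exists_isAtom_le {R : Type*} [Ring R] [IsArtinianRing R] {M : Type*}
    [AddCommGroup M] [Module R M] {N : Submodule R M} (hN : N ≠ ⊥) : ∃ S ≤ N, IsAtom S := by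
  obtain ⟨x, hx, hx0⟩ := N.exists_mem_ne_zero_of_ne_bot hN
  obtain ⟨S, hS, -⟩ := (IsAtomic.eq_bot_or_exists_atom_le
    (⊤ : Submodule R (Submodule.span R {x}))).resolve_left fun h ↦ hx0 <|
      congrArg Subtype.val ((Submodule.eq_bot_iff _).1 h
        ⟨x, Submodule.mem_span_singleton_self x⟩ Submodule.mem_top)
  have := isSimpleModule_iff_isAtom.2 hS
  exact ⟨S.map (Submodule.subtype _),
    (Submodule.map_subtype_le _ _).trans ((Submodule.span_singleton_le_iff_mem _ _).2 hx),
    isSimpleModule_iff_isAtom.1 (IsSimpleModule.congr (Submodule.equivSubtypeMap _ S).symm)⟩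

/-- Over a left Artinian, left self-injective ring, a module with finitely generated socle is
Noetherian. -/
theorem Module.Baer.isNoetherian_of_socle_fg {R : Type*} [Ring R] [IsArtinianRing R]
    (hR : Module.Baer R R) {M : Type*} [AddCommGroup M] [Module R M]
    (hM : (Socle R M).FG) : IsNoetherian R M := by
  have := Module.Finite.of_fg hM
  obtain ⟨t, ht⟩ := Finset.exists_inf_le fun f : M →ₗ[R] R ↦
    (LinearMap.ker f).comap (Socle R M).subtype
  let F : M →ₗ[R] t → R := LinearMap.pi fun f ↦ f.1
  refine isNoetherian_of_injective F (LinearMap.ker_eq_bot.1 ?_)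
  by_contra hne
  obtain ⟨S, hSF, hS⟩ := IsArtinianRing.exists_isAtom_le hne
  have := isSimpleModule_iff_isAtom.2 hS
  obtain ⟨g, hg⟩ := hR.exists_injective_of_isSimpleModule S
  obtain ⟨f, hf⟩ := hR.extension_property S.subtype S.injective_subtype g
  refine hS.1 ((Submodule.eq_bot_iff _).2 fun x hx ↦ ?_)
  have hxs : x ∈ Socle R M := le_sSup (a := S) hS hx
  have hfx : f x = 0 := by
    refine ht f (x := ⟨x, hxs⟩) ?_
    rw [Finset.inf_eq_iInf]
    have hker (f : M →ₗ[R] R) (hf : f ∈ t) : f x = 0 :=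
      congrFun (LinearMap.mem_ker.1 (hSF hx)) ⟨f, hf⟩
    simpa using hker
  have hgx : g ⟨x, hx⟩ = 0 := by rw [← hf]; exact hfx
  exact congrArg Subtype.val (hg (hgx.trans (map_zero g).symm))

/-- Over a quasi-Frobenius ring (Noetherian and self-injective), a module is hereditarily
Bassian iff it is finitely generated iff its socle is finitely generated. -/
theorem quasiFrobenius_hereditarilyBassian_tfae (R : Type*) [Ring R] [IsNoetherianRing R]
    (hinj : Module.Injective R R) (M : Type*) [AddCommGroup M] [Module R M] :
    List.TFAE
      [IsHereditarilyBassian R M,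
       Module.Finite R M,
       (Socle R M).FG] := by
  have hR := Module.Baer.of_injective hinj
  have := hR.isArtinianRing
  tfae_have 1 → 3 := fun h ↦ h.socle_fg
  tfae_have 3 → 2 := fun h ↦
    have := hR.isNoetherian_of_socle_fg h
    inferInstance
  tfae_have 2 → 1 := fun _ ↦ IsNoetherian.isHereditarilyBassian R M
  tfae_finish
end
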